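/- arXiv:1802.06264 — 2 statements merged into one kernel-verified Lean document; each statement's English description precedes it below -/
import Mathlib

section
/- Let X be a complex Hilbert space, let A, B, C : X → X be compact self-adjoint bounded linear operators, and let r₁, r₂ ∈ ℕ. If B − A has at most r₁ negative eigenvalues counted with multiplicity and C − B has at most r₂ negative eigenvalues counted with multiplicity, then C − A has at most r₁ + r₂ negative eigenvalues counted with multiplicity. -/
/-- For a (compact self-adjoint) operator `T` on a complex Hilbert space, `T` has at most `r`
negative eigenvalues counted with multiplicity: the span of the eigenspaces of `T` associated
with negative eigenvalues has dimension at most `r`. -/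
def HasAtMostNegEigenvalues {X : Type*} [NormedAddCommGroup X] [InnerProductSpace ℂ X]
    (T : X →L[ℂ] X) (r : ℕ) : Prop :=
  Module.rank ℂ
    ↥(⨆ μ : ℝ, ⨆ _ : μ < 0, Module.End.eigenspace (T : X →ₗ[ℂ] X) (μ : ℂ)) ≤ r

open Module.End in
/-- A vector in the span of the eigenspaces for the real eigenvalues in a set `s` is a finite sum of
eigenvectors, along which the quadratic form of a symmetric operator is diagonal. -/
theorem LinearMap.IsSymmetric.exists_finset_of_mem_iSup_eigenspace {X : Type*}
    [NormedAddCommGroup X] [InnerProductSpace ℂ X] {T : X →ₗ[ℂ] X} (hT : T.IsSymmetric)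
    {s : Set ℝ} {x : X} (hx : x ∈ ⨆ μ ∈ s, eigenspace T (μ : ℂ)) :
    ∃ (t : Finset s) (f : s → X), (∀ i ∈ t, f i ≠ 0) ∧ ∑ i ∈ t, f i = x ∧
      (inner ℂ (T x) x).re = ∑ i ∈ t, (i : ℝ) * ‖f i‖ ^ 2 := by
  rw [iSup_subtype', Submodule.mem_iSup_iff_exists_finsupp] at hx
  obtain ⟨f, hf, rfl⟩ := hx
  refine ⟨f.support, f, fun i hi => by simpa using hi, rfl, ?_⟩
  have hTf : ∀ i : s, T (f i) = ((i : ℝ) : ℂ) • f i := fun i => mem_eigenspace_iff.mp (hf i)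
  have hfam := hT.orthogonalFamily_eigenspaces.comp
    (Complex.ofReal_injective.comp (Subtype.val_injective (p := (· ∈ s))))
  have key := hfam.inner_sum (fun i => ⟨((i : ℝ) : ℂ) • f i, Submodule.smul_mem _ _ (hf i)⟩)
    (fun i => ⟨f i, hf i⟩) f.support
  simp only [Submodule.coe_inner] at key
  rw [Finsupp.sum, map_sum, Finset.sum_congr rfl fun i _ => hTf i]
  refine (congrArg Complex.re key).trans ?_
  rw [Complex.re_sum]
  refine Finset.sum_congr rfl fun i _ => ?_
  rw [inner_smul_left, inner_self_eq_norm_sq_to_K, Complex.conj_ofReal]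
  norm_cast
  exact Complex.re_ofReal_mul _ _

open Module.End in
/-- The quadratic form of a symmetric operator is negative definite on the span of the eigenspaces
for negative eigenvalues. -/
theorem LinearMap.IsSymmetric.re_inner_neg_of_mem_iSup_eigenspace {X : Type*}
    [NormedAddCommGroup X] [InnerProductSpace ℂ X] {T : X →ₗ[ℂ] X} (hT : T.IsSymmetric)
    {x : X} (hx : x ∈ ⨆ μ : ℝ, ⨆ _ : μ < 0, eigenspace T (μ : ℂ)) (hx0 : x ≠ 0) :
    (inner ℂ (T x) x).re < 0 := by
  obtain ⟨t, f, hf, hsum, hre⟩ :=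
    hT.exists_finset_of_mem_iSup_eigenspace (s := Set.Iio 0) hx
  rw [hre]
  refine Finset.sum_neg (fun i hi => mul_neg_of_neg_of_pos i.2 ?_) ?_
  · exact pow_pos (norm_pos_iff.mpr (hf i hi)) 2
  · rw [Finset.nonempty_iff_ne_empty]
    rintro rfl
    exact hx0 (by simpa using hsum.symm)

open Module.End in
/-- The quadratic form of a compact symmetric operator is nonnegative on the orthogonal complement
of the span of the eigenspaces for negative eigenvalues. -/
theorem ContinuousLinearMap.re_inner_nonneg_of_mem_orthogonal_iSup_eigenspace {X : Type*}
    [NormedAddCommGroup X] [InnerProductSpace ℂ X] [CompleteSpace X] {T : X →L[ℂ] X}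
    (hc : IsCompactOperator T) (hT : T.IsSymmetric) {x : X}
    (hx : x ∈ (⨆ μ : ℝ, ⨆ _ : μ < 0, eigenspace (T : X →ₗ[ℂ] X) (μ : ℂ))ᗮ) :
    0 ≤ (inner ℂ (T x) x).re := by
  set N := ⨆ μ : ℝ, ⨆ _ : μ < 0, eigenspace (T : X →ₗ[ℂ] X) (μ : ℂ) with hN
  set P := ⨆ μ ∈ Set.Ici (0 : ℝ), eigenspace (T : X →ₗ[ℂ] X) (μ : ℂ) with hP
  have hPN : P ⟂ N := by
    simp only [hN, hP, Submodule.isOrtho_iSup_left, Submodule.isOrtho_iSup_right]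
    intro ν hν μ hμ
    refine hT.orthogonalFamily_eigenspaces.isOrtho fun h => ?_
    rw [Complex.ofReal_inj] at h
    exact absurd hν (not_lt.mpr (h ▸ hμ))
  have htop : (P ⊔ N)ᗮ = ⊥ := by
    rw [eq_bot_iff, ← orthogonalComplement_iSup_eigenspaces_eq_bot hc hT]
    refine Submodule.orthogonal_le (iSup_le fun μ => ?_)
    by_cases hμ : HasEigenvalue (T : X →ₗ[ℂ] X) μ
    · obtain ⟨r, rfl⟩ := Complex.conj_eq_iff_real.mp (hT.conj_eigenvalue_eq_self hμ)
      rcases lt_or_ge r 0 with hr | hr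
      · exact le_sup_of_le_right (le_iSup₂_of_le r hr le_rfl)
      · exact le_sup_of_le_left (le_iSup₂_of_le r hr le_rfl)
    · rw [hasEigenvalue_iff, not_not] at hμ
      exact hμ.le.trans bot_le
  have hxP : x ∈ P.topologicalClosure := by
    obtain ⟨p, hp, q, hq, rfl⟩ := P.topologicalClosure.exists_add_mem_mem_orthogonal x
    rw [Submodule.orthogonal_closure] at hq
    have hpN : p ∈ Nᗮ := P.topologicalClosure_minimal hPN N.isClosed_orthogonal hp
    have hq0 : q ∈ (P ⊔ N)ᗮ := by
      rw [← Submodule.inf_orthogonal]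
      exact ⟨hq, by simpa using Submodule.sub_mem _ hx hpN⟩
    rw [htop, Submodule.mem_bot] at hq0
    simpa [hq0] using hp
  have hclosed : IsClosed {y : X | 0 ≤ (inner ℂ (T y) y).re} :=
    isClosed_le continuous_const (by fun_prop)
  refine closure_minimal (fun y hy => ?_) hclosed hxP
  obtain ⟨t, f, -, -, hre⟩ := hT.exists_finset_of_mem_iSup_eigenspace hy
  change 0 ≤ (inner ℂ ((T : X →ₗ[ℂ] X) y) y).re
  rw [hre]
  exact Finset.sum_nonneg fun i _ => mul_nonneg i.2 (sq_nonneg _)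

/-- A subspace that meets the orthogonal complement of `K` trivially has rank at most that of
`K`. -/
theorem Submodule.rank_le_of_disjoint_orthogonal {𝕜 E : Type*} [RCLike 𝕜] [NormedAddCommGroup E]
    [InnerProductSpace 𝕜 E] {N K : Submodule 𝕜 E} [K.HasOrthogonalProjection]
    (h : Disjoint N Kᗮ) : Module.rank 𝕜 N ≤ Module.rank 𝕜 K := by
  refine LinearMap.rank_le_of_injective
    ((K.orthogonalProjectionOnto : E →ₗ[𝕜] K).comp N.subtype) ?_
  rw [injective_iff_map_eq_zero]
  intro x hx
  exact Subtype.ext (Submodule.disjoint_def.mp h x x.2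
    (Submodule.orthogonalProjectionOnto_eq_zero_iff.mp hx))

theorem statement1 {X : Type*} [NormedAddCommGroup X] [InnerProductSpace ℂ X]
    [CompleteSpace X] (A B C : X →L[ℂ] X)
    (hAcomp : IsCompactOperator A) (hBcomp : IsCompactOperator B)
    (hCcomp : IsCompactOperator C)
    (hAsa : IsSelfAdjoint A) (hBsa : IsSelfAdjoint B) (hCsa : IsSelfAdjoint C)
    (r₁ r₂ : ℕ)
    (h₁ : HasAtMostNegEigenvalues (B - A) r₁)
    (h₂ : HasAtMostNegEigenvalues (C - B) r₂) :
    HasAtMostNegEigenvalues (C - A) (r₁ + r₂) := by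
  unfold HasAtMostNegEigenvalues at *
  set N₁ := ⨆ μ : ℝ, ⨆ _ : μ < 0, Module.End.eigenspace ((B - A : X →L[ℂ] X) : X →ₗ[ℂ] X) (μ : ℂ)
  set N₂ := ⨆ μ : ℝ, ⨆ _ : μ < 0, Module.End.eigenspace ((C - B : X →L[ℂ] X) : X →ₗ[ℂ] X) (μ : ℂ)
  have : FiniteDimensional ℂ N₁ :=
    Module.rank_lt_aleph0_iff.mp (h₁.trans_lt Cardinal.natCast_lt_aleph0)
  have : FiniteDimensional ℂ N₂ :=
    Module.rank_lt_aleph0_iff.mp (h₂.trans_lt Cardinal.natCast_lt_aleph0)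
  refine (Submodule.rank_le_of_disjoint_orthogonal (K := N₁ ⊔ N₂) ?_).trans
    ((Submodule.rank_add_le_rank_add_rank N₁ N₂).trans ?_)
  · rw [Submodule.disjoint_def]
    intro x hx hxK
    rw [← Submodule.inf_orthogonal] at hxK
    by_contra hx0
    have hneg := (hCsa.sub hAsa).isSymmetric.re_inner_neg_of_mem_iSup_eigenspace hx hx0
    have hBA := ContinuousLinearMap.re_inner_nonneg_of_mem_orthogonal_iSup_eigenspace
      (hBcomp.sub hAcomp) (hBsa.sub hAsa).isSymmetric hxK.1
    have hCB := ContinuousLinearMap.re_inner_nonneg_of_mem_orthogonal_iSup_eigenspace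
      (hCcomp.sub hBcomp) (hCsa.sub hBsa).isSymmetric hxK.2
    simp only [ContinuousLinearMap.coe_coe, sub_apply, inner_sub_left,
      Complex.sub_re] at hneg hBA hCB
    linarith
  · push_cast
    exact add_le_add h₁ h₂
end

section
/- Let d ∈ {2,3}, k > 0, and 0 < R₀ < R. Let v and w be C² complex-valued functions on ℝ^d ∖ closure(B_{R₀}) satisfying the Helmholtz equation Δv + k²v = 0 and Δw + k²w = 0 there, both satisfying the Sommerfeld radiation condition, and having far field patterns v^∞ and w^∞ on S^{d-1}, respectively. Then ∫_{∂B_R} ( v ∂w̄/∂ν − w̄ ∂v/∂ν ) ds = −2 i k |C_d|² ∫_{S^{d-1}} v^∞(x̂) conj(w^∞(x̂)) ds(x̂), where w̄ denotes the complex conjugate of w. -/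
open MeasureTheory Metric Filter
open scoped RealInnerProductSpace

noncomputable section

/-- The surface measure (Hausdorff measure of dimension `d-1`) on the unit sphere
`S^{d-1} ⊆ ℝ^d`, as a measure on `ℝ^d` supported on the sphere. -/
def sphereMeasure (d : ℕ) : Measure (EuclideanSpace ℝ (Fin d)) :=
  (μH[(d : ℝ) - 1]).restrict (sphere (0 : EuclideanSpace ℝ (Fin d)) 1)

/-- The Herglotz wave function with density `g`:
`u^i_g(x) = ∫_{S^{d-1}} e^{i k x·θ} g(θ) ds(θ)`. -/
def herglotz (d : ℕ) (k : ℝ) (g : EuclideanSpace ℝ (Fin d) → ℂ)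
    (x : EuclideanSpace ℝ (Fin d)) : ℂ :=
  ∫ θ, Complex.exp (Complex.I * k * (⟪x, θ⟫ : ℝ)) * g θ ∂(sphereMeasure d)

/-- The Laplacian of a complex-valued function on `ℝ^d`: the sum of the second partial
derivatives with respect to the standard coordinate directions. -/
def lap (d : ℕ) (u : EuclideanSpace ℝ (Fin d) → ℂ) (x : EuclideanSpace ℝ (Fin d)) : ℂ :=
  ∑ i : Fin d,
    fderiv ℝ (fun y => fderiv ℝ u y (EuclideanSpace.single i 1)) x (EuclideanSpace.single i 1)

/-- The outward normal (radial) derivative of `f` at `y ∈ ∂B_R`: the derivative of `f`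
at `y` in the direction `y/‖y‖`. -/
def nuDeriv (d : ℕ) (f : EuclideanSpace ℝ (Fin d) → ℂ) (y : EuclideanSpace ℝ (Fin d)) : ℂ :=
  fderiv ℝ f y (‖y‖⁻¹ • y)

/-- The constant `C_d`: `C_d = e^{iπ/4}/√(8πk)` if `d = 2` and `C_d = 1/(4π)` if `d = 3`. -/
def Cd (d : ℕ) (k : ℝ) : ℂ :=
  if d = 2 then Complex.exp (Complex.I * (Real.pi / 4)) / ((Real.sqrt (8 * Real.pi * k) : ℝ) : ℂ)
  else 1 / (4 * (Real.pi : ℂ))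

/-- The Sommerfeld radiation condition:
`lim_{r→∞} sup_{|x|=r} r^{(d-1)/2} |∂w/∂r(x) − i k w(x)| = 0`. -/
def Sommerfeld (d : ℕ) (k : ℝ) (w : EuclideanSpace ℝ (Fin d) → ℂ) : Prop :=
  ∀ ε : ℝ, 0 < ε → ∃ R : ℝ, ∀ x : EuclideanSpace ℝ (Fin d), R ≤ ‖x‖ →
    ‖x‖ ^ (((d : ℝ) - 1) / 2) * ‖nuDeriv d w x - Complex.I * k * w x‖ < ε

/-- `winf` is the far field pattern of `w`: `winf` is continuous on the unit sphere and
`|w(x) − C_d e^{ik|x|} |x|^{-(d-1)/2} winf(x/|x|)| ≤ M |x|^{-(d+1)/2}` for all `|x| ≥ R₁`. -/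
def IsFarField (d : ℕ) (k : ℝ) (w winf : EuclideanSpace ℝ (Fin d) → ℂ) : Prop :=
  ContinuousOn winf (sphere (0 : EuclideanSpace ℝ (Fin d)) 1) ∧
  ∃ M R₁ : ℝ, 0 < M ∧ 0 < R₁ ∧ ∀ x : EuclideanSpace ℝ (Fin d), R₁ ≤ ‖x‖ →
    ‖w x - Cd d k * Complex.exp (Complex.I * k * ‖x‖) *
        ((‖x‖ ^ (-(((d : ℝ) - 1) / 2)) : ℝ) : ℂ) * winf (‖x‖⁻¹ • x)‖ ≤
      M * ‖x‖ ^ (-(((d : ℝ) + 1) / 2))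

section Measure

variable {E : Type*} [NormedAddCommGroup E] [InnerProductSpace ℝ E] [MeasurableSpace E]
  [BorelSpace E]

theorem integral_sphere_eq_smul_integral_unit_sphere {s : ℝ} (hs : 0 ≤ s) {r : ℝ} (hr : 0 < r)
    (f : E → ℂ) :
    ∫ y in sphere (0 : E) r, f y ∂μH[s] =
      ((r ^ s : ℝ) : ℂ) * ∫ x in sphere (0 : E) 1, f (r • x) ∂μH[s] := by
  have hr0 : r ≠ 0 := hr.ne'
  have hpre : (fun x : E => r • x) ⁻¹' sphere (0 : E) r = sphere (0 : E) 1 := by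
    ext x
    simp [norm_smul, abs_of_pos hr, hr0]
  have hemb : MeasurableEmbedding (fun x : E => r • x) :=
    (Homeomorph.smulOfNeZero r hr0).measurableEmbedding
  have hmap : Measure.map (fun x : E => r • x) (μH[s] : Measure E) =
      (‖r‖₊⁻¹ ^ s) • (μH[s] : Measure E) := by
    ext t ht
    rw [hemb.map_apply, Measure.smul_apply, Set.preimage_smul₀ hr0,
      Measure.hausdorffMeasure_smul₀ hs (inv_ne_zero hr0), nnnorm_inv]
  have h1 : ∫ x in sphere (0 : E) 1, f (r • x) ∂μH[s] =
      (‖r‖₊⁻¹ ^ s) • ∫ y in sphere (0 : E) r, f y ∂μH[s] := by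
    rw [← hpre, ← hemb.setIntegral_map, hmap, Measure.restrict_smul, integral_smul_nnreal_measure]
  have h2 : ((‖r‖₊⁻¹ ^ s : NNReal) : ℝ) = (r ^ s)⁻¹ := by
    rw [NNReal.coe_rpow, NNReal.coe_inv, coe_nnnorm, Real.norm_of_nonneg hr.le,
      Real.inv_rpow hr.le]
  have h3 : ((r ^ s : ℝ) : ℂ) ≠ 0 := by exact_mod_cast (Real.rpow_pos_of_pos hr s).ne'
  rw [h1, NNReal.smul_def, h2, Complex.real_smul, Complex.ofReal_inv, mul_inv_cancel_left₀ h3]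

variable [FiniteDimensional ℝ E]

theorem hausdorffMeasure_hemisphere_lt_top {n : ℕ} (hn : Module.finrank ℝ E = n + 1) {p : E}
    (hp : ‖p‖ = 1) : μH[(n : ℝ)] (sphere (0 : E) 1 ∩ {y | ⟪p, y⟫ ≤ 0}) < ⊤ := by
  have hfact : Fact (Module.finrank ℝ E = n + 1) := ⟨hn⟩
  have hp0 : p ≠ 0 := by rintro rfl; simp at hp
  set K : Set E := sphere (0 : E) 1 ∩ {y | ⟪p, y⟫ ≤ 0} with hK
  have hKc : IsCompact K := (isCompact_sphere 0 1).inter_right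
    (isClosed_le (by fun_prop) continuous_const)
  have hne : K ⊆ {x | innerSL ℝ p x ≠ (1 : ℝ)} := by
    rintro x ⟨-, hx⟩ h
    simp only [Set.mem_ofPred_eq] at hx
    rw [innerSL_apply_apply] at h
    linarith
  have hTc : IsCompact (stereoToFun p '' K) :=
    hKc.image_of_continuousOn (continuousOn_stereoToFun.mono hne)
  set f : (ℝ ∙ p)ᗮ → E := fun w => stereoInvFunAux p (w : E) with hf
  have hfd : ContDiff ℝ 1 f := contDiff_stereoInvFunAux.comp (ℝ ∙ p)ᗮ.subtypeL.contDiff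
  obtain ⟨C, hC⟩ :=
    hfd.locallyLipschitz.locallyLipschitzOn.exists_lipschitzOnWith_of_compact hTc
  have hsub : K ⊆ f '' (stereoToFun p '' K) := by
    intro x hx
    refine ⟨_, ⟨x, hx, rfl⟩, ?_⟩
    have hxp : x ≠ p := by
      rintro rfl
      have := hx.2
      simp only [Set.mem_ofPred_eq, real_inner_self_eq_norm_sq, hp] at this
      norm_num at this
    exact congrArg Subtype.val (stereo_left_inv hp (x := ⟨x, hx.1⟩) hxp)
  have hfin : Module.finrank ℝ (ℝ ∙ p)ᗮ = n := Submodule.finrank_orthogonal_span_singleton hp0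
  have hT : μH[(n : ℝ)] (stereoToFun p '' K) < ⊤ := by
    have h := hTc.measure_lt_top (μ := μH[(Module.finrank ℝ (ℝ ∙ p)ᗮ : ℝ)])
    rwa [hfin] at h
  calc μH[(n : ℝ)] K ≤ μH[(n : ℝ)] (f '' (stereoToFun p '' K)) := measure_mono hsub
    _ ≤ (C : ENNReal) ^ (n : ℝ) * μH[(n : ℝ)] (stereoToFun p '' K) :=
      hC.hausdorffMeasure_image_le n.cast_nonneg
    _ < ⊤ := ENNReal.mul_lt_top (ENNReal.rpow_lt_top_of_nonneg n.cast_nonneg ENNReal.coe_ne_top) hT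

theorem hausdorffMeasure_sphere_lt_top {n : ℕ} (hn : Module.finrank ℝ E = n + 1) :
    μH[(n : ℝ)] (sphere (0 : E) 1) < ⊤ := by
  have : Nontrivial E := Module.nontrivial_of_finrank_pos (R := ℝ) (by omega)
  obtain ⟨p, hp⟩ := exists_norm_eq E zero_le_one
  have hsub : sphere (0 : E) 1 ⊆
      (sphere (0 : E) 1 ∩ {y | ⟪p, y⟫ ≤ 0}) ∪ (sphere (0 : E) 1 ∩ {y | ⟪-p, y⟫ ≤ 0}) := by
    intro x hx
    rcases le_total ⟪p, x⟫ 0 with h | h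
    · exact Or.inl ⟨hx, h⟩
    · exact Or.inr ⟨hx, by simpa [inner_neg_left] using h⟩
  refine (measure_mono hsub).trans_lt ((measure_union_le _ _).trans_lt ?_)
  exact ENNReal.add_lt_top.2 ⟨hausdorffMeasure_hemisphere_lt_top hn hp,
    hausdorffMeasure_hemisphere_lt_top hn (by rwa [norm_neg])⟩

end Measure

theorem hasDerivAt_setIntegral_of_isCompact {X : Type*} [TopologicalSpace X] [T2Space X]
    [MeasurableSpace X] [OpensMeasurableSpace X] [TopologicalSpace.PseudoMetrizableSpace X]
    {μ : Measure X} {K : Set X} (hK : IsCompact K) (hμ : μ K < ⊤) {U : Set ℝ} (hU : IsOpen U)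
    {t₀ : ℝ} (ht₀ : t₀ ∈ U) {F F' : ℝ → X → ℂ} (hF : ∀ t ∈ U, ContinuousOn (F t) K)
    (hF' : ContinuousOn (Function.uncurry F') (U ×ˢ K))
    (hderiv : ∀ x ∈ K, ∀ t ∈ U, HasDerivAt (F · x) (F' t x) t) :
    HasDerivAt (fun t => ∫ x in K, F t x ∂μ) (∫ x in K, F' t₀ x ∂μ) t₀ := by
  have hKm : MeasurableSet K := hK.measurableSet
  have : IsFiniteMeasure (μ.restrict K) := ⟨by simpa using hμ⟩
  obtain ⟨ε, hε, hεU⟩ := Metric.nhds_basis_closedBall.mem_iff.1 (hU.mem_nhds ht₀)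
  obtain ⟨C, hC⟩ := ((isCompact_closedBall t₀ ε).prod hK).exists_bound_of_continuousOn
    (hF'.mono (Set.prod_mono hεU subset_rfl))
  have hmeas : ∀ t ∈ U, AEStronglyMeasurable (F t) (μ.restrict K) := fun t ht =>
    (hF t ht).aestronglyMeasurable_of_isCompact hK hKm
  refine (hasDerivAt_integral_of_dominated_loc_of_deriv_le (bound := fun _ => C)
    (closedBall_mem_nhds t₀ hε) ?_ ?_ ?_ ?_ (integrable_const C) ?_).2
  · filter_upwards [hU.mem_nhds ht₀] with t ht using hmeas t ht
  · exact (hF t₀ ht₀).integrableOn_of_subset_isCompact hK hKm subset_rfl hμ.ne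
  · exact (hF'.comp (f := fun x => (t₀, x)) (s := K) (by fun_prop) fun x hx => ⟨ht₀, hx⟩ :
      ContinuousOn (F' t₀) K).aestronglyMeasurable_of_isCompact hK hKm
  · exact (ae_restrict_mem hKm).mono fun x hx t ht => hC (t, x) ⟨ht, hx⟩
  · exact (ae_restrict_mem hKm).mono fun x hx t ht => hderiv x hx t (hεU ht)

section Rotation

variable {E : Type*} [NormedAddCommGroup E] [InnerProductSpace ℝ E] [MeasurableSpace E]
  [BorelSpace E]

theorem integral_sphere_comp_linearIsometryEquiv (s : ℝ) (e : E ≃ₗᵢ[ℝ] E) (g : E → ℂ) :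
    ∫ x in sphere (0 : E) 1, g (e x) ∂μH[s] = ∫ x in sphere (0 : E) 1, g x ∂μH[s] := by
  have hpre : e ⁻¹' sphere (0 : E) 1 = sphere (0 : E) 1 := by
    ext x
    simp
  have h := (e.toIsometryEquiv.measurePreserving_hausdorffMeasure s).setIntegral_preimage_emb
    e.toHomeomorph.measurableEmbedding g (sphere (0 : E) 1)
  rw [← h]
  exact (congrArg (fun t => ∫ x in t, g (e x) ∂μH[s]) hpre).symm

variable [FiniteDimensional ℝ E]

theorem integral_sphere_fderiv_skewAdjoint {s : ℝ} (hs : μH[s] (sphere (0 : E) 1) < ⊤)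
    {A : E →L[ℝ] E} (hA : A ∈ skewAdjoint (E →L[ℝ] E)) {U : Set E} (hU : IsOpen U)
    (hSU : sphere (0 : E) 1 ⊆ U) {g : E → ℂ} (hg : ContDiffOn ℝ 1 g U) :
    ∫ x in sphere (0 : E) 1, fderiv ℝ g x (A x) ∂μH[s] = 0 := by
  set ρ : ℝ → E →L[ℝ] E := fun t => NormedSpace.exp (t • A) with hρ
  have : NormedAlgebra ℚ (E →L[ℝ] E) := NormedAlgebra.restrictScalars ℚ ℝ _
  have hunit : ∀ t, ρ t ∈ unitary (E →L[ℝ] E) := fun t =>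
    NormedSpace.exp_mem_unitary_of_mem_skewAdjoint (skewAdjoint.smul_mem t hA)
  have hnorm : ∀ t x, ‖ρ t x‖ = ‖x‖ := fun t x =>
    (Unitary.linearIsometryEquiv ⟨ρ t, hunit t⟩).norm_map x
  have hmem : ∀ t, ∀ x ∈ sphere (0 : E) 1, ρ t x ∈ sphere (0 : E) 1 := by
    intro t x hx
    rw [mem_sphere_zero_iff_norm] at hx ⊢
    rw [hnorm, hx]
  have hρd : ∀ t, HasDerivAt ρ (A * ρ t) t := fun t => hasDerivAt_exp_smul_const' A t
  have hρc : Continuous ρ := continuous_iff_continuousAt.2 fun t => (hρd t).continuousAt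
  have hρapp : Continuous fun p : ℝ × E => ρ p.1 p.2 := by fun_prop
  have hgd : ContinuousOn (fderiv ℝ g) U := hg.continuousOn_fderiv_of_isOpen hU le_rfl
  have key := hasDerivAt_setIntegral_of_isCompact (μ := μH[s]) (isCompact_sphere (0 : E) 1) hs
    isOpen_univ (Set.mem_univ (0 : ℝ)) (F := fun t x => g (ρ t x))
    (F' := fun t x => fderiv ℝ g (ρ t x) (A (ρ t x)))
    (fun t _ => hg.continuousOn.comp (by fun_prop) fun x hx => hSU (hmem t x hx))
    (ContinuousOn.clm_apply
      (hgd.comp hρapp.continuousOn fun p hp => hSU (hmem _ _ hp.2))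
      (A.continuous.comp hρapp).continuousOn)
    (fun x hx t _ => by
      have h1 : HasDerivAt (fun t => ρ t x) (A (ρ t x)) t := by
        simpa using (hρd t).clm_apply (hasDerivAt_const t x)
      have h2 : DifferentiableAt ℝ g (ρ t x) :=
        (hg.differentiableOn one_ne_zero).differentiableAt (hU.mem_nhds (hSU (hmem t x hx)))
      exact h2.hasFDerivAt.comp_hasDerivAt t h1)
  have hconst : (fun t => ∫ x in sphere (0 : E) 1, g (ρ t x) ∂μH[s]) =
      fun _ => ∫ x in sphere (0 : E) 1, g x ∂μH[s] := by
    funext t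
    exact integral_sphere_comp_linearIsometryEquiv s (Unitary.linearIsometryEquiv ⟨ρ t, hunit t⟩) g
  have hρ0 : ρ 0 = 1 := by simp [hρ]
  rw [hconst] at key
  simpa [hρ0] using key.unique (hasDerivAt_const _ _)

end Rotation

section Wronskian

variable {E : Type*} [NormedAddCommGroup E] [NormedSpace ℝ E]

/-- The first order form `v du - u dv`. -/
def wronskian (v u : E → ℂ) (y : E) : E →L[ℝ] ℂ :=
  v y • fderiv ℝ u y - u y • fderiv ℝ v y

/-- The second order form `v D²u - u D²v`. -/
def wronskianHessian (v u : E → ℂ) (y : E) : E →L[ℝ] E →L[ℝ] ℂ :=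
  v y • fderiv ℝ (fderiv ℝ u) y - u y • fderiv ℝ (fderiv ℝ v) y

variable {v u : E → ℂ} {U : Set E}

theorem contDiffOn_wronskian (hU : IsOpen U) (hv : ContDiffOn ℝ 2 v U)
    (hu : ContDiffOn ℝ 2 u U) : ContDiffOn ℝ 1 (wronskian v u) U :=
  ((hv.of_le one_le_two).smul (hu.fderiv_of_isOpen hU (by norm_num))).sub
    ((hu.of_le one_le_two).smul (hv.fderiv_of_isOpen hU (by norm_num)))

theorem continuousOn_wronskianHessian_apply {X : Type*} [TopologicalSpace X] {s : Set X}
    (hU : IsOpen U) (hv : ContDiffOn ℝ 2 v U) (hu : ContDiffOn ℝ 2 u U) {c a : X → E}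
    (hc : ContinuousOn c s) (ha : ContinuousOn a s) (hcU : Set.MapsTo c s U) :
    ContinuousOn (fun p => wronskianHessian v u (c p) (a p) (a p)) s := by
  have h : ∀ {f : E → ℂ}, ContDiffOn ℝ 2 f U →
      ContinuousOn (fun p => fderiv ℝ (fderiv ℝ f) (c p) (a p) (a p)) s := fun hf =>
    ((((hf.fderiv_of_isOpen (m := 1) hU (by norm_num)).continuousOn_fderiv_of_isOpen hU
      le_rfl).comp hc hcU).clm_apply ha).clm_apply ha
  exact ((hv.continuousOn.comp hc hcU).mul (h hu)).sub ((hu.continuousOn.comp hc hcU).mul (h hv))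

theorem continuousOn_wronskian_apply {X : Type*} [TopologicalSpace X] {s : Set X}
    (hU : IsOpen U) (hv : ContDiffOn ℝ 2 v U) (hu : ContDiffOn ℝ 2 u U) {c a : X → E}
    (hc : ContinuousOn c s) (ha : ContinuousOn a s) (hcU : Set.MapsTo c s U) :
    ContinuousOn (fun p => wronskian v u (c p) (a p)) s :=
  ((contDiffOn_wronskian hU hv hu).continuousOn.comp hc hcU).clm_apply ha

/-- Along a curve whose velocity is parallel to the vector being tested, the products of first
derivatives cancel. -/
theorem hasDerivAt_wronskian_comp (hU : IsOpen U) (hv : ContDiffOn ℝ 2 v U)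
    (hu : ContDiffOn ℝ 2 u U) {c a : ℝ → E} {a' : E} {t ρ : ℝ} (hc : HasDerivAt c (ρ • a t) t)
    (ha : HasDerivAt a a' t) (hct : c t ∈ U) :
    HasDerivAt (fun s => wronskian v u (c s) (a s))
      (ρ * wronskianHessian v u (c t) (a t) (a t) + wronskian v u (c t) a') t := by
  have h0 : ∀ {f : E → ℂ}, ContDiffOn ℝ 2 f U →
      HasDerivAt (fun s => f (c s)) (fderiv ℝ f (c t) (ρ • a t)) t := fun hf =>
    ((hf.differentiableOn two_ne_zero).differentiableAt
      (hU.mem_nhds hct)).hasFDerivAt.comp_hasDerivAt t hc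
  have h1 : ∀ {f : E → ℂ}, ContDiffOn ℝ 2 f U →
      HasDerivAt (fun s => fderiv ℝ f (c s) (a s))
        (fderiv ℝ (fderiv ℝ f) (c t) (ρ • a t) (a t) + fderiv ℝ f (c t) a') t := fun hf =>
    ((((hf.fderiv_of_isOpen (m := 1) hU (by norm_num)).differentiableOn
      one_ne_zero).differentiableAt
      (hU.mem_nhds hct)).hasFDerivAt.comp_hasDerivAt t hc).clm_apply ha
  have h := ((h0 hv).mul (h1 hu)).sub ((h0 hu).mul (h1 hv))
  convert! h using 1
  simp [wronskian, wronskianHessian]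
  ring

end Wronskian

section PlaneRotation

variable {E : Type*} [NormedAddCommGroup E] [InnerProductSpace ℝ E]

/-- The infinitesimal rotation in the plane spanned by `a` and `b`. -/
def planeRotation (a b : E) : E →L[ℝ] E :=
  (innerSL ℝ a).smulRight b - (innerSL ℝ b).smulRight a

theorem planeRotation_apply (a b x : E) :
    planeRotation a b x = ⟪a, x⟫ • b - ⟪b, x⟫ • a := by
  simp [planeRotation]

variable {ι : Type*} [Fintype ι] (b : OrthonormalBasis ι ℝ E)

theorem sum_bilinear_planeRotation (B : E →L[ℝ] E →L[ℝ] ℂ) (x : E) :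
    ∑ i, ∑ j, B (planeRotation (b i) (b j) x) (planeRotation (b i) (b j) x) =
      2 * ((‖x‖ ^ 2 : ℝ) : ℂ) * ∑ i, B (b i) (b i) - 2 * B x x := by
  have hsq : ((‖x‖ ^ 2 : ℝ) : ℂ) = ∑ i, (⟪b i, x⟫ : ℂ) ^ 2 := by
    rw [← b.sum_sq_norm_inner_right x]
    push_cast
    refine Finset.sum_congr rfl fun i _ => ?_
    rw [← Complex.ofReal_pow, Real.norm_eq_abs, sq_abs, Complex.ofReal_pow]
  have hB : B x x = ∑ i, ∑ j, (⟪b i, x⟫ : ℂ) * (⟪b j, x⟫ : ℂ) * B (b i) (b j) := by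
    conv_lhs => rw [← b.sum_repr' x]
    simp only [map_sum, map_smul, sum_apply, smul_apply,
      Complex.real_smul, Finset.mul_sum]
    rw [Finset.sum_comm]
    refine Finset.sum_congr rfl fun i _ => Finset.sum_congr rfl fun j _ => ?_
    ring
  have hB' : B x x = ∑ i, ∑ j, (⟪b i, x⟫ : ℂ) * (⟪b j, x⟫ : ℂ) * B (b j) (b i) := by
    rw [hB, Finset.sum_comm]
    refine Finset.sum_congr rfl fun i _ => Finset.sum_congr rfl fun j _ => ?_
    ring
  have h1 : ((‖x‖ ^ 2 : ℝ) : ℂ) * ∑ i, B (b i) (b i) =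
      ∑ i, ∑ j, (⟪b i, x⟫ : ℂ) ^ 2 * B (b j) (b j) := by
    rw [hsq, Finset.sum_mul_sum]
  have h2 : ((‖x‖ ^ 2 : ℝ) : ℂ) * ∑ i, B (b i) (b i) =
      ∑ i, ∑ j, (⟪b j, x⟫ : ℂ) ^ 2 * B (b i) (b i) := by
    rw [h1, Finset.sum_comm]
  have hsplit : 2 * ((‖x‖ ^ 2 : ℝ) : ℂ) * ∑ i, B (b i) (b i) - 2 * B x x =
      ((‖x‖ ^ 2 : ℝ) : ℂ) * ∑ i, B (b i) (b i) + ((‖x‖ ^ 2 : ℝ) : ℂ) * ∑ i, B (b i) (b i)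
        - B x x - B x x := by ring
  rw [hsplit]
  nth_rewrite 1 [h1]
  rw [h2]
  nth_rewrite 1 [hB]
  rw [hB']
  simp only [← Finset.sum_add_distrib, ← Finset.sum_sub_distrib]
  refine Finset.sum_congr rfl fun i _ => Finset.sum_congr rfl fun j _ => ?_
  simp only [planeRotation_apply, map_sub, map_smul, sub_apply,
    smul_apply, Complex.real_smul]
  ring

theorem sum_planeRotation_sq (x : E) :
    ∑ i, ∑ j, planeRotation (b i) (b j) (planeRotation (b i) (b j) x) =
      (-2 * ((Fintype.card ι : ℝ) - 1)) • x := by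
  classical
  have h : ∀ i j, planeRotation (b i) (b j) (planeRotation (b i) (b j) x) =
      (if i = j then (2 : ℝ) • ⟪b i, x⟫ • b i else 0) - ⟪b j, x⟫ • b j - ⟪b i, x⟫ • b i := by
    intro i j
    simp only [planeRotation_apply, inner_sub_right, real_inner_smul_right,
      orthonormal_iff_ite.1 b.orthonormal]
    rcases eq_or_ne i j with rfl | hij
    · simp
      module
    · simp [hij, hij.symm]
  simp only [h, Finset.sum_sub_distrib, Finset.sum_ite_eq, Finset.mem_univ, if_true,
    Finset.sum_const, ← Finset.smul_sum, b.sum_repr', Finset.card_univ]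
  module

variable [FiniteDimensional ℝ E]

theorem planeRotation_mem_skewAdjoint (a b : E) :
    planeRotation a b ∈ skewAdjoint (E →L[ℝ] E) := by
  rw [skewAdjoint.mem_iff, ContinuousLinearMap.star_eq_adjoint, eq_comm,
    ContinuousLinearMap.eq_adjoint_iff]
  intro x y
  simp only [neg_apply, planeRotation_apply, inner_neg_left, inner_sub_left,
    inner_sub_right, real_inner_smul_left, real_inner_smul_right, real_inner_comm x]
  ring

end PlaneRotation

section SkewAdjoint

variable {E : Type*} [NormedAddCommGroup E] [InnerProductSpace ℝ E] [FiniteDimensional ℝ E]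
  [MeasurableSpace E] [BorelSpace E]

theorem integral_sphere_wronskian_skewAdjoint {s : ℝ} (hs : μH[s] (sphere (0 : E) 1) < ⊤)
    {A : E →L[ℝ] E} (hA : A ∈ skewAdjoint (E →L[ℝ] E)) {U : Set E} (hU : IsOpen U) {r : ℝ}
    (hSU : ∀ x ∈ sphere (0 : E) 1, r • x ∈ U) {v u : E → ℂ} (hv : ContDiffOn ℝ 2 v U)
    (hu : ContDiffOn ℝ 2 u U) :
    ∫ x in sphere (0 : E) 1, (r * wronskianHessian v u (r • x) (A x) (A x) +
      wronskian v u (r • x) (A (A x))) ∂μH[s] = 0 := by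
  have hsm : ContDiff ℝ 1 (fun x : E => r • x) := by fun_prop
  have hV : IsOpen ((fun x : E => r • x) ⁻¹' U) := hU.preimage hsm.continuous
  have hg : ContDiffOn ℝ 1 (fun x => wronskian v u (r • x) (A x)) ((fun x : E => r • x) ⁻¹' U) :=
    ((contDiffOn_wronskian hU hv hu).comp hsm.contDiffOn fun _ hx => hx).clm_apply
      A.contDiff.contDiffOn
  rw [← integral_sphere_fderiv_skewAdjoint hs hA hV hSU hg]
  refine setIntegral_congr_fun isClosed_sphere.measurableSet fun x hx => ?_
  have hline : HasDerivAt (fun t : ℝ => x + t • A x) (A x) 0 := by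
    simpa using ((hasDerivAt_id (0 : ℝ)).smul_const (A x)).const_add x
  have hd : HasFDerivAt (fun x => wronskian v u (r • x) (A x))
      (fderiv ℝ (fun x => wronskian v u (r • x) (A x)) x) (x + (0 : ℝ) • A x) := by
    rw [zero_smul, add_zero]
    exact ((hg.differentiableOn one_ne_zero).differentiableAt
      (hV.mem_nhds (hSU x hx))).hasFDerivAt
  have h1 := hd.comp_hasDerivAt (0 : ℝ) hline
  have h2 := hasDerivAt_wronskian_comp hU hv hu (t := 0) (ρ := r)
    (c := fun t : ℝ => r • (x + t • A x)) (a := fun t : ℝ => A (x + t • A x))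
    (by simpa only [zero_smul, add_zero] using hline.fun_const_smul r)
    (A.hasFDerivAt.comp_hasDerivAt (0 : ℝ) hline) (by simpa using hSU x hx)
  simpa using h2.unique h1

end SkewAdjoint

section FarField

/-- The factor `e^{-ikr} r^{(d-1)/2}` that turns an outgoing wave into its far field. -/
def outgoingFactor (d : ℕ) (k r : ℝ) : ℂ :=
  Complex.exp (-(Complex.I * k * r)) * ((r ^ (((d : ℝ) - 1) / 2) : ℝ) : ℂ)

theorem norm_outgoingFactor (d : ℕ) (k : ℝ) {r : ℝ} (hr : 0 < r) :
    ‖outgoingFactor d k r‖ = r ^ (((d : ℝ) - 1) / 2) := by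
  have h : -(Complex.I * k * r) = ((-(k * r) : ℝ) : ℂ) * Complex.I := by
    push_cast
    ring
  rw [outgoingFactor, norm_mul, h, Complex.norm_exp_ofReal_mul_I, one_mul, Complex.norm_real,
    Real.norm_of_nonneg (Real.rpow_nonneg hr.le _)]

theorem outgoingFactor_mul_conj (d : ℕ) (k : ℝ) {r : ℝ} (hr : 0 < r) :
    outgoingFactor d k r * (starRingEnd ℂ) (outgoingFactor d k r) =
      ((r ^ ((d : ℝ) - 1) : ℝ) : ℂ) := by
  rw [Complex.mul_conj, Complex.normSq_eq_norm_sq, norm_outgoingFactor d k hr, ← Real.rpow_natCast,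
    ← Real.rpow_mul hr.le]
  norm_num

variable {d : ℕ} {k : ℝ} {f finf : EuclideanSpace ℝ (Fin d) → ℂ}

theorem norm_smul_of_mem_sphere {x : EuclideanSpace ℝ (Fin d)}
    (hx : x ∈ sphere (0 : EuclideanSpace ℝ (Fin d)) 1) {r : ℝ} (hr : 0 < r) : ‖r • x‖ = r := by
  rw [norm_smul, mem_sphere_zero_iff_norm.1 hx, mul_one, Real.norm_of_nonneg hr.le]

theorem inv_norm_smul_smul_of_mem_sphere {x : EuclideanSpace ℝ (Fin d)}
    (hx : x ∈ sphere (0 : EuclideanSpace ℝ (Fin d)) 1) {r : ℝ} (hr : 0 < r) :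
    ‖r • x‖⁻¹ • r • x = x := by
  rw [norm_smul_of_mem_sphere hx hr, inv_smul_smul₀ hr.ne']

theorem IsFarField.exists_norm_sub_le (h : IsFarField d k f finf) :
    ∃ M : ℝ, ∀ᶠ r in atTop, ∀ x ∈ sphere (0 : EuclideanSpace ℝ (Fin d)) 1,
      ‖outgoingFactor d k r * f (r • x) - Cd d k * finf x‖ ≤ M * r⁻¹ := by
  obtain ⟨-, M, R₁, -, hR₁, hM⟩ := h
  refine ⟨M, ?_⟩
  filter_upwards [eventually_ge_atTop R₁] with r hr x hx
  have hr0 : 0 < r := hR₁.trans_le hr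
  have hnorm := norm_smul_of_mem_sphere hx hr0
  have hb := hM (r • x) (by rwa [hnorm])
  rw [inv_norm_smul_smul_of_mem_sphere hx hr0, hnorm] at hb
  have hexp : Complex.exp (-(Complex.I * k * r)) * Complex.exp (Complex.I * k * r) = 1 := by
    rw [← Complex.exp_add, neg_add_cancel, Complex.exp_zero]
  have hpow : ((r ^ (((d : ℝ) - 1) / 2) : ℝ) : ℂ) * ((r ^ (-(((d : ℝ) - 1) / 2)) : ℝ) : ℂ) = 1 := by
    rw [← Complex.ofReal_mul, ← Real.rpow_add hr0, add_neg_cancel, Real.rpow_zero,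
      Complex.ofReal_one]
  have hfac : outgoingFactor d k r * f (r • x) - Cd d k * finf x = outgoingFactor d k r *
      (f (r • x) - Cd d k * Complex.exp (Complex.I * k * r) *
        ((r ^ (-(((d : ℝ) - 1) / 2)) : ℝ) : ℂ) * finf x) := by
    rw [outgoingFactor]
    linear_combination (Cd d k * finf x) * hexp + (Cd d k * finf x) *
      Complex.exp (-(Complex.I * k * r)) * Complex.exp (Complex.I * k * r) * hpow
  rw [hfac, norm_mul, norm_outgoingFactor d k hr0]
  refine (mul_le_mul_of_nonneg_left hb (Real.rpow_nonneg hr0.le _)).trans_eq ?_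
  rw [mul_left_comm, ← Real.rpow_add hr0, ← Real.rpow_neg_one]
  congr 2
  ring

theorem Sommerfeld.eventually_norm_lt (h : Sommerfeld d k f) {ε : ℝ} (hε : 0 < ε) :
    ∀ᶠ r in atTop, ∀ x ∈ sphere (0 : EuclideanSpace ℝ (Fin d)) 1,
      ‖outgoingFactor d k r * nuDeriv d f (r • x) -
        Complex.I * k * (outgoingFactor d k r * f (r • x))‖ < ε := by
  obtain ⟨R, hR⟩ := h ε hε
  filter_upwards [eventually_ge_atTop R, eventually_gt_atTop 0] with r hr hr0 x hx
  have hnorm := norm_smul_of_mem_sphere hx hr0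
  have hb := hR (r • x) (by rwa [hnorm])
  rw [hnorm, ← norm_outgoingFactor d k hr0, ← norm_mul] at hb
  convert hb using 2
  ring

theorem IsFarField.tendsto_outgoingFactor_mul (h : IsFarField d k f finf)
    {x : EuclideanSpace ℝ (Fin d)} (hx : x ∈ sphere (0 : EuclideanSpace ℝ (Fin d)) 1) :
    Tendsto (fun r : ℝ => outgoingFactor d k r * f (r • x)) atTop (nhds (Cd d k * finf x)) := by
  obtain ⟨M, hM⟩ := h.exists_norm_sub_le
  rw [tendsto_iff_norm_sub_tendsto_zero]
  refine squeeze_zero' (Eventually.of_forall fun _ => norm_nonneg _) (hM.mono fun r hr => hr x hx) ?_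
  simpa using tendsto_inv_atTop_zero.const_mul M

theorem Sommerfeld.tendsto_outgoingFactor_mul_nuDeriv (hS : Sommerfeld d k f)
    (h : IsFarField d k f finf) {x : EuclideanSpace ℝ (Fin d)}
    (hx : x ∈ sphere (0 : EuclideanSpace ℝ (Fin d)) 1) :
    Tendsto (fun r : ℝ => outgoingFactor d k r * nuDeriv d f (r • x)) atTop
      (nhds (Complex.I * k * (Cd d k * finf x))) := by
  have h0 : Tendsto (fun r : ℝ => outgoingFactor d k r * nuDeriv d f (r • x) -
      Complex.I * k * (outgoingFactor d k r * f (r • x))) atTop (nhds 0) := by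
    rw [Metric.tendsto_nhds]
    intro ε hε
    filter_upwards [hS.eventually_norm_lt hε] with r hr
    simpa using hr x hx
  simpa using h0.add ((h.tendsto_outgoingFactor_mul hx).const_mul (Complex.I * k))

theorem IsFarField.exists_bound (h : IsFarField d k f finf) :
    ∃ A : ℝ, ∀ᶠ r in atTop, ∀ x ∈ sphere (0 : EuclideanSpace ℝ (Fin d)) 1,
      ‖outgoingFactor d k r * f (r • x)‖ ≤ A := by
  obtain ⟨M, hM⟩ := h.exists_norm_sub_le
  obtain ⟨B, hB⟩ := (isCompact_sphere (0 : EuclideanSpace ℝ (Fin d)) 1).exists_bound_of_continuousOn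
    (continuousOn_const.mul h.1 : ContinuousOn (fun x => Cd d k * finf x) _)
  refine ⟨1 + B, ?_⟩
  have hsmall : ∀ᶠ r : ℝ in atTop, M * r⁻¹ < 1 := by
    have ht : Tendsto (fun r : ℝ => M * r⁻¹) atTop (nhds 0) := by
      simpa using tendsto_inv_atTop_zero.const_mul M
    exact ht.eventually_lt_const one_pos
  filter_upwards [hM, hsmall] with r hr hr1 x hx
  calc ‖outgoingFactor d k r * f (r • x)‖
      ≤ ‖outgoingFactor d k r * f (r • x) - Cd d k * finf x‖ + ‖Cd d k * finf x‖ := by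
        simpa using norm_add_le (outgoingFactor d k r * f (r • x) - Cd d k * finf x)
          (Cd d k * finf x)
    _ ≤ 1 + B := add_le_add ((hr x hx).trans hr1.le) (hB x hx)

theorem Sommerfeld.exists_bound_nuDeriv (hS : Sommerfeld d k f) (h : IsFarField d k f finf) :
    ∃ A : ℝ, ∀ᶠ r in atTop, ∀ x ∈ sphere (0 : EuclideanSpace ℝ (Fin d)) 1,
      ‖outgoingFactor d k r * nuDeriv d f (r • x)‖ ≤ A := by
  obtain ⟨A, hA⟩ := h.exists_bound
  refine ⟨1 + ‖Complex.I * (k : ℂ)‖ * A, ?_⟩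
  filter_upwards [hA, hS.eventually_norm_lt one_pos] with r hr hr1 x hx
  have h1 := norm_add_le (outgoingFactor d k r * nuDeriv d f (r • x) -
    Complex.I * k * (outgoingFactor d k r * f (r • x)))
    (Complex.I * k * (outgoingFactor d k r * f (r • x)))
  rw [sub_add_cancel, norm_mul (Complex.I * (k : ℂ))] at h1
  exact h1.trans (add_le_add (hr1 x hx).le
    (mul_le_mul_of_nonneg_left (hr x hx) (norm_nonneg _)))

/-- The density `v ∂w̄/∂ν - w̄ ∂v/∂ν`. -/
def flux (d : ℕ) (v w : EuclideanSpace ℝ (Fin d) → ℂ) (y : EuclideanSpace ℝ (Fin d)) : ℂ :=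
  v y * (starRingEnd ℂ) (nuDeriv d w y) - (starRingEnd ℂ) (w y) * nuDeriv d v y

theorem rpow_mul_flux (v w : EuclideanSpace ℝ (Fin d) → ℂ) (y : EuclideanSpace ℝ (Fin d)) (k : ℝ)
    {r : ℝ} (hr : 0 < r) :
    ((r ^ ((d : ℝ) - 1) : ℝ) : ℂ) * flux d v w y =
      (outgoingFactor d k r * v y) * (starRingEnd ℂ) (outgoingFactor d k r * nuDeriv d w y) -
        (starRingEnd ℂ) (outgoingFactor d k r * w y) * (outgoingFactor d k r * nuDeriv d v y) := by
  rw [← outgoingFactor_mul_conj d k hr, flux, map_mul, map_mul]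
  ring

theorem tendsto_integral_flux {v w vinf winf : EuclideanSpace ℝ (Fin d) → ℂ}
    (hfin : μH[(d : ℝ) - 1] (sphere (0 : EuclideanSpace ℝ (Fin d)) 1) < ⊤)
    (hmeas : ∀ᶠ r : ℝ in atTop, ContinuousOn (fun x => flux d v w (r • x))
      (sphere (0 : EuclideanSpace ℝ (Fin d)) 1))
    (hvSom : Sommerfeld d k v) (hwSom : Sommerfeld d k w)
    (hvinf : IsFarField d k v vinf) (hwinf : IsFarField d k w winf) :
    Tendsto (fun r : ℝ => ∫ x in sphere (0 : EuclideanSpace ℝ (Fin d)) 1,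
        ((r ^ ((d : ℝ) - 1) : ℝ) : ℂ) * flux d v w (r • x) ∂μH[(d : ℝ) - 1]) atTop
      (nhds (-(2 * Complex.I * k * ((‖Cd d k‖ : ℝ) : ℂ) ^ 2) *
        ∫ x in sphere (0 : EuclideanSpace ℝ (Fin d)) 1,
          vinf x * (starRingEnd ℂ) (winf x) ∂μH[(d : ℝ) - 1])) := by
  have hSm : MeasurableSet (sphere (0 : EuclideanSpace ℝ (Fin d)) 1) :=
    isClosed_sphere.measurableSet
  have : IsFiniteMeasure
      ((μH[(d : ℝ) - 1]).restrict (sphere (0 : EuclideanSpace ℝ (Fin d)) 1)) :=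
    ⟨by simpa using hfin⟩
  obtain ⟨A, hA⟩ := hvinf.exists_bound
  obtain ⟨A', hA'⟩ := hvSom.exists_bound_nuDeriv hvinf
  obtain ⟨B, hB⟩ := hwinf.exists_bound
  obtain ⟨B', hB'⟩ := hwSom.exists_bound_nuDeriv hwinf
  rw [← integral_const_mul]
  refine tendsto_integral_filter_of_dominated_convergence (fun _ => A * B' + B * A') ?_ ?_
    (integrable_const _) ?_
  · filter_upwards [hmeas] with r hr
    exact (continuousOn_const.mul hr).aestronglyMeasurable_of_isCompact (isCompact_sphere 0 1) hSm
  · filter_upwards [hA, hA', hB, hB', eventually_gt_atTop 0] with r hr hr' hs hs' hr0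
    refine (ae_restrict_mem hSm).mono fun x hx => ?_
    have hle : ∀ a b c e : ℂ, ‖a * (starRingEnd ℂ) b - (starRingEnd ℂ) c * e‖ ≤
        ‖a‖ * ‖b‖ + ‖c‖ * ‖e‖ := fun a b c e => by
      simpa only [norm_mul, Complex.norm_conj] using
        norm_sub_le (a * (starRingEnd ℂ) b) ((starRingEnd ℂ) c * e)
    rw [rpow_mul_flux v w _ k hr0]
    exact (hle _ _ _ _).trans <| add_le_add
      (mul_le_mul (hr x hx) (hs' x hx) (norm_nonneg _) ((norm_nonneg _).trans (hr x hx)))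
      (mul_le_mul (hs x hx) (hr' x hx) (norm_nonneg _) ((norm_nonneg _).trans (hs x hx)))
  · refine (ae_restrict_mem hSm).mono fun x hx => ?_
    have hlim := ((hvinf.tendsto_outgoingFactor_mul hx).mul
      ((Complex.continuous_conj.tendsto _).comp
        (hwSom.tendsto_outgoingFactor_mul_nuDeriv hwinf hx))).sub
      (((Complex.continuous_conj.tendsto _).comp (hwinf.tendsto_outgoingFactor_mul hx)).mul
        (hvSom.tendsto_outgoingFactor_mul_nuDeriv hvinf hx))
    have hval : -(2 * Complex.I * k * ((‖Cd d k‖ : ℝ) : ℂ) ^ 2) *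
        (vinf x * (starRingEnd ℂ) (winf x)) =
        Cd d k * vinf x * (starRingEnd ℂ) (Complex.I * k * (Cd d k * winf x)) -
          (starRingEnd ℂ) (Cd d k * winf x) * (Complex.I * k * (Cd d k * vinf x)) := by
      rw [← Complex.mul_conj']
      simp only [map_mul, Complex.conj_I, Complex.conj_ofReal]
      ring
    rw [hval]
    refine hlim.congr' ?_
    filter_upwards [eventually_gt_atTop 0] with r hr0
    exact (rpow_mul_flux v w _ k hr0).symm
end FarField

section Constancy

variable {E : Type*} [NormedAddCommGroup E] [InnerProductSpace ℝ E] [FiniteDimensional ℝ E]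
  [MeasurableSpace E] [BorelSpace E] {ι : Type*} [Fintype ι] (b : OrthonormalBasis ι ℝ E)
  {s : ℝ} {U : Set E} {v u : E → ℂ}

theorem integral_sphere_wronskian_radial (hs : μH[s] (sphere (0 : E) 1) < ⊤) (hU : IsOpen U)
    {r : ℝ} (hSU : ∀ x ∈ sphere (0 : E) 1, r • x ∈ U) (hv : ContDiffOn ℝ 2 v U)
    (hu : ContDiffOn ℝ 2 u U) (htr : ∀ y ∈ U, ∑ i, wronskianHessian v u y (b i) (b i) = 0) :
    ∫ x in sphere (0 : E) 1, (r * wronskianHessian v u (r • x) x x +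
      ((Fintype.card ι : ℂ) - 1) * wronskian v u (r • x) x) ∂μH[s] = 0 := by
  set S : Set E := sphere (0 : E) 1 with hS
  set A : ι → ι → E →L[ℝ] E := fun i j => planeRotation (b i) (b j) with hA
  have hSm : MeasurableSet S := isClosed_sphere.measurableSet
  have hsm : ContinuousOn (fun x : E => r • x) S := by fun_prop
  have hint : ∀ i j, IntegrableOn (fun x => r * wronskianHessian v u (r • x) (A i j x) (A i j x) +
      wronskian v u (r • x) (A i j (A i j x))) S μH[s] := by
    intro i j
    refine ContinuousOn.integrableOn_of_subset_isCompact ?_ (isCompact_sphere 0 1) hSm subset_rfl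
      hs.ne
    exact (continuousOn_const.mul (continuousOn_wronskianHessian_apply hU hv hu hsm
      (A i j).continuous.continuousOn hSU)).add (continuousOn_wronskian_apply hU hv hu hsm
      ((A i j).continuous.comp (A i j).continuous).continuousOn hSU)
  have hsum : ∫ x in S, ∑ i, ∑ j, (r * wronskianHessian v u (r • x) (A i j x) (A i j x) +
      wronskian v u (r • x) (A i j (A i j x))) ∂μH[s] = 0 := by
    rw [integral_finsetSum _ fun i _ => integrable_finsetSum _ fun j _ => hint i j]
    refine Finset.sum_eq_zero fun i _ => ?_
    rw [integral_finsetSum _ fun j _ => hint i j]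
    exact Finset.sum_eq_zero fun j _ => integral_sphere_wronskian_skewAdjoint hs
      (planeRotation_mem_skewAdjoint _ _) hU hSU hv hu
  have hpt : ∀ x ∈ S, ∑ i, ∑ j, (r * wronskianHessian v u (r • x) (A i j x) (A i j x) +
      wronskian v u (r • x) (A i j (A i j x))) =
      -2 * (r * wronskianHessian v u (r • x) x x +
        ((Fintype.card ι : ℂ) - 1) * wronskian v u (r • x) x) := by
    intro x hx
    simp only [Finset.sum_add_distrib, ← Finset.mul_sum, ← map_sum, hA]
    rw [sum_bilinear_planeRotation, sum_planeRotation_sq, htr _ (hSU x hx), map_smul,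
      Complex.real_smul]
    push_cast
    ring
  rw [setIntegral_congr_fun hSm hpt, integral_const_mul] at hsum
  exact (mul_eq_zero.1 hsum).resolve_left (by norm_num)

theorem hasDerivAt_integral_sphere_wronskian (hcard : s = (Fintype.card ι : ℝ) - 1)
    (hs : μH[s] (sphere (0 : E) 1) < ⊤) (hU : IsOpen U) {R₀ : ℝ} (hR₀ : 0 ≤ R₀)
    (hSU : ∀ r, R₀ < r → ∀ x ∈ sphere (0 : E) 1, r • x ∈ U) (hv : ContDiffOn ℝ 2 v U)
    (hu : ContDiffOn ℝ 2 u U) (htr : ∀ y ∈ U, ∑ i, wronskianHessian v u y (b i) (b i) = 0)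
    {r : ℝ} (hr : R₀ < r) :
    HasDerivAt (fun t : ℝ => ∫ x in sphere (0 : E) 1,
      ((t ^ s : ℝ) : ℂ) * wronskian v u (t • x) x ∂μH[s]) 0 r := by
  have hmaps : Set.MapsTo (fun p : ℝ × E => p.1 • p.2) (Set.Ioi R₀ ×ˢ sphere (0 : E) 1) U :=
    fun p hp => hSU p.1 hp.1 p.2 hp.2
  have key := hasDerivAt_setIntegral_of_isCompact (μ := μH[s]) (isCompact_sphere (0 : E) 1) hs
    isOpen_Ioi (Set.mem_Ioi.2 hr)
    (F := fun t x => ((t ^ s : ℝ) : ℂ) * wronskian v u (t • x) x)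
    (F' := fun t x => ((t ^ (s - 1) : ℝ) : ℂ) * (t * wronskianHessian v u (t • x) x x +
      ((Fintype.card ι : ℂ) - 1) * wronskian v u (t • x) x))
    (fun t ht => continuousOn_const.mul (continuousOn_wronskian_apply hU hv hu (by fun_prop)
      continuousOn_id (hSU t ht)))
    (by
      have hW := continuousOn_wronskian_apply hU hv hu (a := Prod.snd)
        (by fun_prop : ContinuousOn (fun p : ℝ × E => p.1 • p.2) _) continuousOn_snd hmaps
      have hH := continuousOn_wronskianHessian_apply hU hv hu (a := Prod.snd)
        (by fun_prop : ContinuousOn (fun p : ℝ × E => p.1 • p.2) _) continuousOn_snd hmaps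
      have hpow : ContinuousOn (fun p : ℝ × E => ((p.1 ^ (s - 1) : ℝ) : ℂ))
          (Set.Ioi R₀ ×ˢ sphere (0 : E) 1) :=
        Complex.continuous_ofReal.comp_continuousOn (continuousOn_fst.rpow_const
          fun p hp => Or.inl (hR₀.trans_lt hp.1).ne')
      exact hpow.mul (((Complex.continuous_ofReal.comp continuous_fst).continuousOn.mul hH).add
        (continuousOn_const.mul hW)))
    (by
      intro x hx t ht
      have ht0 : 0 < t := hR₀.trans_lt ht
      have hW := hasDerivAt_wronskian_comp hU hv hu (t := t) (ρ := 1) (c := fun t : ℝ => t • x)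
        (a := fun _ => x) (by simpa using (hasDerivAt_id t).smul_const x) (hasDerivAt_const t x)
        (hSU t ht x hx)
      have hpow : HasDerivAt (fun t : ℝ => ((t ^ s : ℝ) : ℂ)) ((s * t ^ (s - 1) : ℝ) : ℂ) t :=
        (Real.hasDerivAt_rpow_const (Or.inl ht0.ne')).ofReal_comp
      convert! hpow.mul hW using 1
      have hts : t ^ s = t ^ (s - 1) * t := by
        rw [← Real.rpow_add_one ht0.ne', sub_add_cancel]
      have hsC : (s : ℂ) = (Fintype.card ι : ℂ) - 1 := by
        rw [hcard]
        push_cast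
        rfl
      rw [hts, ← hsC]
      simp only [Complex.ofReal_mul, Complex.ofReal_one, map_zero]
      ring)
  rwa [integral_const_mul, integral_sphere_wronskian_radial b hs hU (hSU r hr) hv hu htr,
    mul_zero] at key

end Constancy

section Helmholtz

variable {d : ℕ} {k : ℝ} {f : EuclideanSpace ℝ (Fin d) → ℂ}

theorem lap_eq_sum_fderiv_fderiv {U : Set (EuclideanSpace ℝ (Fin d))} (hU : IsOpen U)
    (hf : ContDiffOn ℝ 2 f U) {x : EuclideanSpace ℝ (Fin d)} (hx : x ∈ U) :
    lap d f x = ∑ i, fderiv ℝ (fderiv ℝ f) x (EuclideanSpace.basisFun (Fin d) ℝ i)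
      (EuclideanSpace.basisFun (Fin d) ℝ i) := by
  refine Finset.sum_congr rfl fun i _ => ?_
  have hd : DifferentiableAt ℝ (fderiv ℝ f) x :=
    ((hf.fderiv_of_isOpen (m := 1) hU (by norm_num)).differentiableOn
      one_ne_zero).differentiableAt (hU.mem_nhds hx)
  rw [EuclideanSpace.basisFun_apply, fderiv_clm_apply hd (differentiableAt_const _)]
  simp

theorem fderiv_conj_comp_apply (f : EuclideanSpace ℝ (Fin d) → ℂ)
    (x h : EuclideanSpace ℝ (Fin d)) :
    fderiv ℝ (fun y => (starRingEnd ℂ) (f y)) x h = (starRingEnd ℂ) (fderiv ℝ f x h) :=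
  DFunLike.congr_fun (Complex.conjCLE.comp_fderiv (f := f) (x := x)) h

theorem lap_conj (f : EuclideanSpace ℝ (Fin d) → ℂ) (x : EuclideanSpace ℝ (Fin d)) :
    lap d (fun y => (starRingEnd ℂ) (f y)) x = (starRingEnd ℂ) (lap d f x) := by
  simp only [lap, fderiv_conj_comp_apply, map_sum]

theorem sum_wronskianHessian_eq_zero {U : Set (EuclideanSpace ℝ (Fin d))} (hU : IsOpen U)
    {v u : EuclideanSpace ℝ (Fin d) → ℂ} (hv : ContDiffOn ℝ 2 v U) (hu : ContDiffOn ℝ 2 u U)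
    {x : EuclideanSpace ℝ (Fin d)} (hx : x ∈ U) (hvx : lap d v x + (k : ℂ) ^ 2 * v x = 0)
    (hux : lap d u x + (k : ℂ) ^ 2 * u x = 0) :
    ∑ i, wronskianHessian v u x (EuclideanSpace.basisFun (Fin d) ℝ i)
      (EuclideanSpace.basisFun (Fin d) ℝ i) = 0 := by
  simp only [wronskianHessian, sub_apply, smul_apply, smul_eq_mul, Finset.sum_sub_distrib,
    ← Finset.mul_sum]
  rw [← lap_eq_sum_fderiv_fderiv hU hv hx, ← lap_eq_sum_fderiv_fderiv hU hu hx]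
  linear_combination v x * hux - u x * hvx

theorem flux_smul_eq_wronskian (v w : EuclideanSpace ℝ (Fin d) → ℂ)
    {x : EuclideanSpace ℝ (Fin d)} (hx : x ∈ sphere (0 : EuclideanSpace ℝ (Fin d)) 1) {r : ℝ}
    (hr : 0 < r) :
    flux d v w (r • x) = wronskian v (fun y => (starRingEnd ℂ) (w y)) (r • x) x := by
  simp [flux, nuDeriv, wronskian, inv_norm_smul_smul_of_mem_sphere hx hr, fderiv_conj_comp_apply]

end Helmholtz

theorem statement14 (d : ℕ) (hd : d = 2 ∨ d = 3) (k : ℝ) (hk : 0 < k)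
    (R₀ R : ℝ) (hR₀ : 0 < R₀) (hR : R₀ < R)
    (v w vinf winf : EuclideanSpace ℝ (Fin d) → ℂ)
    (hv : ContDiffOn ℝ 2 v (closedBall (0 : EuclideanSpace ℝ (Fin d)) R₀)ᶜ)
    (hw : ContDiffOn ℝ 2 w (closedBall (0 : EuclideanSpace ℝ (Fin d)) R₀)ᶜ)
    (hvHelm : ∀ x ∈ (closedBall (0 : EuclideanSpace ℝ (Fin d)) R₀)ᶜ,
      lap d v x + (k : ℂ) ^ 2 * v x = 0)
    (hwHelm : ∀ x ∈ (closedBall (0 : EuclideanSpace ℝ (Fin d)) R₀)ᶜ,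
      lap d w x + (k : ℂ) ^ 2 * w x = 0)
    (hvSom : Sommerfeld d k v) (hwSom : Sommerfeld d k w)
    (hvinf : IsFarField d k v vinf) (hwinf : IsFarField d k w winf) :
    (∫ y in sphere (0 : EuclideanSpace ℝ (Fin d)) R,
        (v y * (starRingEnd ℂ) (nuDeriv d w y) -
          (starRingEnd ℂ) (w y) * nuDeriv d v y) ∂(μH[(d : ℝ) - 1])) =
      -(2 * Complex.I * k * ((‖Cd d k‖ : ℝ) : ℂ) ^ 2) *
        ∫ xh in sphere (0 : EuclideanSpace ℝ (Fin d)) 1,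
          vinf xh * (starRingEnd ℂ) (winf xh) ∂(μH[(d : ℝ) - 1]) := by
  have hd1 : 1 ≤ d := by omega
  have hdR : ((d - 1 : ℕ) : ℝ) = (d : ℝ) - 1 := by simp [hd1]
  set S : Set (EuclideanSpace ℝ (Fin d)) := sphere 0 1 with hS
  set U : Set (EuclideanSpace ℝ (Fin d)) := (closedBall 0 R₀)ᶜ with hUdef
  set u : EuclideanSpace ℝ (Fin d) → ℂ := fun y => (starRingEnd ℂ) (w y) with hudef
  have hfin : μH[(d : ℝ) - 1] S < ⊤ := by
    have h := hausdorffMeasure_sphere_lt_top (E := EuclideanSpace ℝ (Fin d)) (n := d - 1)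
      (by rw [finrank_euclideanSpace_fin]; omega)
    rwa [hdR] at h
  have hU : IsOpen U := isClosed_closedBall.isOpen_compl
  have hSU : ∀ r, R₀ < r → ∀ x ∈ S, r • x ∈ U := by
    intro r hr x hx
    rw [hUdef, Set.mem_compl_iff, mem_closedBall_zero_iff,
      norm_smul_of_mem_sphere hx (hR₀.trans hr)]
    exact hr.not_ge
  have hu : ContDiffOn ℝ 2 u U := Complex.conjCLE.contDiff.comp_contDiffOn hw
  have huHelm : ∀ x ∈ U, lap d u x + (k : ℂ) ^ 2 * u x = 0 := by
    intro x hx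
    simpa [hudef, lap_conj] using congrArg (starRingEnd ℂ) (hwHelm x hx)
  set J : ℝ → ℂ := fun r => ∫ x in S, ((r ^ ((d : ℝ) - 1) : ℝ) : ℂ) * wronskian v u (r • x) x
    ∂μH[(d : ℝ) - 1] with hJ
  have hJflux : ∀ r, R₀ < r → ∫ x in S, ((r ^ ((d : ℝ) - 1) : ℝ) : ℂ) * flux d v w (r • x)
      ∂μH[(d : ℝ) - 1] = J r := by
    intro r hr
    refine setIntegral_congr_fun isClosed_sphere.measurableSet fun x hx => ?_
    simp only [flux_smul_eq_wronskian v w hx (hR₀.trans hr), hudef]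
  have hderiv : ∀ r, R₀ < r → HasDerivAt J 0 r := fun r hr =>
    hasDerivAt_integral_sphere_wronskian (EuclideanSpace.basisFun (Fin d) ℝ) (by simp) hfin hU
      hR₀.le hSU hv hu
      (fun y hy => sum_wronskianHessian_eq_zero hU hv hu hy (hvHelm y hy) (huHelm y hy)) hr
  have hconst : ∀ r, R₀ < r → J r = J R := fun r hr =>
    isOpen_Ioi.is_const_of_deriv_eq_zero isPreconnected_Ioi
      (fun t ht => (hderiv t ht).differentiableAt.differentiableWithinAt)
      (fun t ht => (hderiv t ht).deriv) hr hR
  have hlim := tendsto_integral_flux hfin (v := v) (w := w) (k := k) (by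
    filter_upwards [eventually_gt_atTop R₀] with r hr
    exact (continuousOn_wronskian_apply hU hv hu (by fun_prop) continuousOn_id (hSU r hr)).congr
      fun x hx => flux_smul_eq_wronskian v w hx (hR₀.trans hr)) hvSom hwSom hvinf hwinf
  have hJR : ∫ y in sphere (0 : EuclideanSpace ℝ (Fin d)) R, flux d v w y ∂μH[(d : ℝ) - 1] =
      J R := by
    rw [← hJflux R hR, integral_const_mul]
    exact integral_sphere_eq_smul_integral_unit_sphere (by rw [← hdR]; positivity)
      (hR₀.trans hR) _
  refine hJR.trans (tendsto_nhds_unique (tendsto_const_nhds.congr' ?_) hlim)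
  filter_upwards [eventually_gt_atTop R₀] with r hr
  rw [hJflux r hr, hconst r hr]
end
end
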